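/- arXiv:2106.03305 — 2 statements merged into one kernel-verified Lean document; each statement's English description precedes it below -/
import Mathlib

section
/- Let s, t be distinct vertices. There exists exactly one latest minimum (s,t)-cut side; equivalently, if S₁ and S₂ are both minimum (s,t)-cut sides whose cardinality is minimum among all minimum (s,t)-cut sides, then S₁ = S₂. -/
open Finset

variable {V : Type*}

/-- The cut value of a set `S`: total weight of pairs crossing `(S, Sᶜ)`. -/
def cutValue [Fintype V] [DecidableEq V] (w : V → V → ℝ) (S : Finset V) : ℝ :=
  ∑ x ∈ S, ∑ y ∈ Sᶜ, w x y

/-- `S` is an `(s,t)`-cut side if `s ∈ S` and `t ∉ S`. -/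
def IsCutSide [Fintype V] [DecidableEq V] (s t : V) (S : Finset V) : Prop :=
  s ∈ S ∧ t ∉ S

/-- `S` is a minimum `(s,t)`-cut side. -/
def IsMinCutSide [Fintype V] [DecidableEq V] (w : V → V → ℝ) (s t : V) (S : Finset V) : Prop :=
  IsCutSide s t S ∧ ∀ S' : Finset V, IsCutSide s t S' → cutValue w S ≤ cutValue w S'

/-- `S` is a latest minimum `(s,t)`-cut side: a minimum cut side of minimum cardinality
among all minimum cut sides. -/
def IsLatestMinCutSide [Fintype V] [DecidableEq V] (w : V → V → ℝ) (s t : V) (S : Finset V) : Prop :=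
  IsMinCutSide w s t S ∧ ∀ S' : Finset V, IsMinCutSide w s t S' → S.card ≤ S'.card

/-- The cut value as a sum over all ordered pairs of vertices. -/
lemma cutValue_eq_sum_ite [Fintype V] [DecidableEq V] (w : V → V → ℝ) (S : Finset V) :
    cutValue w S = ∑ x, ∑ y, if x ∈ S ∧ y ∉ S then w x y else 0 := by
  simp only [cutValue, ite_and, ← mem_compl, sum_ite_irrel, sum_const_zero, sum_ite_mem, univ_inter]

/-- The cut function of a nonnegatively weighted graph is submodular. -/
lemma cutValue_inter_add_cutValue_union_le [Fintype V] [DecidableEq V] {w : V → V → ℝ}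
    (hnonneg : ∀ x y, 0 ≤ w x y) (A B : Finset V) :
    cutValue w (A ∩ B) + cutValue w (A ∪ B) ≤ cutValue w A + cutValue w B := by
  simp only [cutValue_eq_sum_ite, ← sum_add_distrib]
  refine sum_le_sum fun x _ => sum_le_sum fun y _ => ?_
  have := hnonneg x y
  by_cases hxA : x ∈ A <;> by_cases hxB : x ∈ B <;> by_cases hyA : y ∈ A <;>
    by_cases hyB : y ∈ B <;> simp [hxA, hxB, hyA, hyB, this]

/-- Minimum cut sides are closed under intersection. -/
lemma IsMinCutSide.inter [Fintype V] [DecidableEq V] {w : V → V → ℝ}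
    (hnonneg : ∀ x y, 0 ≤ w x y) {s t : V} {A B : Finset V}
    (hA : IsMinCutSide w s t A) (hB : IsMinCutSide w s t B) :
    IsMinCutSide w s t (A ∩ B) := by
  obtain ⟨⟨hsA, htA⟩, hminA⟩ := hA
  obtain ⟨⟨hsB, htB⟩, hminB⟩ := hB
  refine ⟨⟨mem_inter.2 ⟨hsA, hsB⟩, fun h => htA (mem_inter.1 h).1⟩, fun S hS => ?_⟩
  have hunion : cutValue w B ≤ cutValue w (A ∪ B) :=
    hminB _ ⟨mem_union_left _ hsA, by simp [htA, htB]⟩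
  linarith [cutValue_inter_add_cutValue_union_le hnonneg A B, hminA S hS]

lemma exists_isMinCutSide [Fintype V] [DecidableEq V] (w : V → V → ℝ) {s t : V} (hst : s ≠ t) :
    ∃ S, IsMinCutSide w s t S :=
  Set.exists_min_image {S | IsCutSide s t S} (cutValue w) (Set.toFinite _)
    ⟨{s}, by simp [IsCutSide, hst.symm]⟩

lemma exists_isLatestMinCutSide [Fintype V] [DecidableEq V] (w : V → V → ℝ) {s t : V}
    (hst : s ≠ t) : ∃ S, IsLatestMinCutSide w s t S :=
  Set.exists_min_image {S | IsMinCutSide w s t S} card (Set.toFinite _)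
    (exists_isMinCutSide w hst)

/-- A latest minimum cut side is contained in every minimum cut side. -/
lemma IsLatestMinCutSide.subset [Fintype V] [DecidableEq V] {w : V → V → ℝ}
    (hnonneg : ∀ x y, 0 ≤ w x y) {s t : V} {A B : Finset V}
    (hA : IsLatestMinCutSide w s t A) (hB : IsMinCutSide w s t B) : A ⊆ B :=
  inter_eq_left.1 <|
    eq_of_subset_of_card_le inter_subset_left (hA.2 _ (hA.1.inter hnonneg hB))

theorem latest_min_cut_exists_unique [Fintype V] [DecidableEq V] [Nonempty V] (w : V → V → ℝ)
    (hsymm : ∀ x y, w x y = w y x) (hnonneg : ∀ x y, 0 ≤ w x y)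
    (hzero : ∀ x, w x x = 0)
    (s t : V) (hst : s ≠ t) :
    ∃! S : Finset V, IsLatestMinCutSide w s t S := by
  obtain ⟨S, hS⟩ := exists_isLatestMinCutSide w hst
  exact ⟨S, hS, fun T hT => (hT.subset hnonneg hS.1).antisymm (hS.subset hnonneg hT.1)⟩
end

section
/- Let p be a pivot vertex and T a set of vertices with p ∉ T. Let u, v ∈ T be distinct, let K_u be the latest minimum (u,p)-cut side and K_v the latest minimum (v,p)-cut side. If K_u ∩ T = {u} and K_v ∩ T = {v}, then K_u ∩ K_v = ∅. -/
open Finset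

variable {V : Type*}

theorem two_mul_cutValue [Fintype V] [DecidableEq V] (w : V → V → ℝ)
    (hsymm : ∀ x y, w x y = w y x) (S : Finset V) :
    2 * cutValue w S = ∑ x, ∑ y, if x ∈ S ↔ y ∈ S then 0 else w x y := by
  have h : cutValue w S = ∑ x, ∑ y, if x ∈ S ∧ y ∉ S then w x y else 0 := by
    rw [cutValue, ← sum_product', ← sum_product', ← sum_filter]
    congr 1
    ext
    simp
  have h' : cutValue w S = ∑ x, ∑ y, if y ∈ S ∧ x ∉ S then w x y else 0 := by
    rw [h, sum_comm]
    simp only [hsymm]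
  rw [two_mul]
  nth_rw 1 [h]
  rw [h']
  simp only [← sum_add_distrib]
  refine sum_congr rfl fun x _ => sum_congr rfl fun y _ => ?_
  by_cases hx : x ∈ S <;> by_cases hy : y ∈ S <;> simp [hx, hy]

/-- Posimodularity of the cut function of an undirected graph. -/
theorem cutValue_sdiff_add_cutValue_sdiff_le [Fintype V] [DecidableEq V] (w : V → V → ℝ)
    (hsymm : ∀ x y, w x y = w y x) (hnonneg : ∀ x y, 0 ≤ w x y) (A B : Finset V) :
    cutValue w (A \ B) + cutValue w (B \ A) ≤ cutValue w A + cutValue w B := by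
  refine le_of_mul_le_mul_left ?_ (two_pos : (0 : ℝ) < 2)
  simp only [mul_add, two_mul_cutValue w hsymm, ← sum_add_distrib]
  refine sum_le_sum fun x _ => sum_le_sum fun y _ => ?_
  have := hnonneg x y
  by_cases hxA : x ∈ A <;> by_cases hxB : x ∈ B <;> by_cases hyA : y ∈ A <;>
    by_cases hyB : y ∈ B <;> simp [hxA, hxB, hyA, hyB, this]

theorem isolating_latest_cuts_disjoint [Fintype V] [DecidableEq V] [Nonempty V] (w : V → V → ℝ)
    (hsymm : ∀ x y, w x y = w y x) (hnonneg : ∀ x y, 0 ≤ w x y)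
    (hzero : ∀ x, w x x = 0)
    (p : V) (T : Finset V) (hpT : p ∉ T)
    (u v : V) (hu : u ∈ T) (hv : v ∈ T) (huv : u ≠ v)
    (Ku Kv : Finset V)
    (hKu : IsLatestMinCutSide w u p Ku) (hKv : IsLatestMinCutSide w v p Kv)
    (hKuT : Ku ∩ T = {u}) (hKvT : Kv ∩ T = {v}) :
    Ku ∩ Kv = ∅ := by
  obtain ⟨⟨⟨huKu, hpKu⟩, hminu⟩, hlatest⟩ := hKu
  obtain ⟨⟨⟨hvKv, hpKv⟩, hminv⟩, -⟩ := hKv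
  have huKv : u ∉ Kv := fun h =>
    huv (mem_singleton.1 (hKvT ▸ mem_inter.2 ⟨h, hu⟩))
  have hvKu : v ∉ Ku := fun h =>
    huv (mem_singleton.1 (hKuT ▸ mem_inter.2 ⟨h, hv⟩)).symm
  have hsideu : IsCutSide u p (Ku \ Kv) :=
    ⟨mem_sdiff.2 ⟨huKu, huKv⟩, fun h => hpKu (mem_sdiff.1 h).1⟩
  have hsidev : IsCutSide v p (Kv \ Ku) :=
    ⟨mem_sdiff.2 ⟨hvKv, hvKu⟩, fun h => hpKv (mem_sdiff.1 h).1⟩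
  have hle : cutValue w (Ku \ Kv) ≤ cutValue w Ku := by
    linarith [cutValue_sdiff_add_cutValue_sdiff_le w hsymm hnonneg Ku Kv, hminv _ hsidev]
  have hcard := hlatest _ ⟨hsideu, fun S' hS' => hle.trans (hminu S' hS')⟩
  exact disjoint_iff_inter_eq_empty.1
    (sdiff_eq_left.1 (eq_of_subset_of_card_le sdiff_subset hcard))
end
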